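/- Fix n ≥ m ≥ 1 and consider n+m qubits whose sites are partitioned into sets A and B with |A| = n and |B| = m. Let H = Σ_{i ∈ B} Σ_{j ∈ A} H_{ij} be the complete bipartite Quantum Max Cut Hamiltonian. Then the sum-of-squares matrix identity holds: (2/(n+1))·Σ_{i ∈ B} (((n+1)/2)·I − Σ_{j ∈ A} H_{ij})² + (m/(n+1))·Σ_{j < k ∈ A} H_{jk} = (m(n+1)/2)·I − H. In particular (m(n+1)/2)·I − H is positive semidefinite, so λ_max(H) ≤ m(n+1)/2. -/

import Mathlib

open Matrix Finset
open scoped ComplexOrder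

noncomputable section

/-- The SWAP matrix on qubits indexed by `V`, exchanging tensor factors `i` and `j`. -/
def swapMat {V : Type*} [Fintype V] [DecidableEq V] (i j : V) :
    Matrix (V → Fin 2) (V → Fin 2) ℂ :=
  Matrix.of fun f g => if f ∘ (Equiv.swap i j) = g then 1 else 0

/-- The singlet projector `H_{ij} = (I - P_{ij})/2`. -/
def singletProj {V : Type*} [Fintype V] [DecidableEq V] (i j : V) :
    Matrix (V → Fin 2) (V → Fin 2) ℂ :=
  (2 : ℂ)⁻¹ • (1 - swapMat i j)

/-- The complete bipartite Quantum Max Cut Hamiltonian on sites `A ⊕ B` with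
`|A| = n`, `|B| = m`. -/
def bipartiteHam (n m : ℕ) :
    Matrix ((Fin n ⊕ Fin m) → Fin 2) ((Fin n ⊕ Fin m) → Fin 2) ℂ :=
  ∑ i : Fin m, ∑ j : Fin n, singletProj (Sum.inr i) (Sum.inl j)

theorem swapMat_mul_apply {V : Type*} [Fintype V] [DecidableEq V] (i j k l : V) (f g : V → Fin 2) :
    (swapMat i j * swapMat k l) f g =
      if f ∘ (Equiv.swap i j) ∘ (Equiv.swap k l) = g then 1 else 0 := by
  rw [Matrix.mul_apply, Finset.sum_eq_single (f ∘ Equiv.swap i j)]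
  · simp [swapMat, Function.comp_assoc]
  · intro h _ hne
    simp [swapMat, hne.symm]
  · simp

theorem swapMat_self {V : Type*} [Fintype V] [DecidableEq V] (i : V) : swapMat i i = 1 := by
  ext f g
  simp [swapMat, Matrix.one_apply]

theorem swapMat_comm {V : Type*} [Fintype V] [DecidableEq V] (i j : V) :
    swapMat i j = swapMat j i := by
  rw [swapMat, swapMat, Equiv.swap_comm]

theorem swapMat_mul_self {V : Type*} [Fintype V] [DecidableEq V] (i j : V) :
    swapMat i j * swapMat i j = 1 := by
  ext f g
  rw [swapMat_mul_apply, ← Equiv.coe_trans]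
  simp [Matrix.one_apply, Equiv.swap_swap]

theorem comp_swap_eq_self {V W : Type*} [DecidableEq V] {f : V → W} {a b : V} (h : f a = f b) :
    f ∘ Equiv.swap a b = f := by
  ext x
  simp only [Function.comp_apply, Equiv.swap_apply_def]
  split_ifs <;> simp_all

/-- The antisymmetrizer on three qubits vanishes. -/
theorem swapMat_anticomm {V : Type*} [Fintype V] [DecidableEq V] {i j k : V}
    (hij : i ≠ j) (hik : i ≠ k) (hjk : j ≠ k) :
    swapMat i j * swapMat i k + swapMat i k * swapMat i j =
      swapMat i j + swapMat i k + swapMat j k - 1 := by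
  have e₁ : (Equiv.swap i j : V → V) ∘ Equiv.swap i k = Equiv.swap j k ∘ Equiv.swap i j := by
    ext x; simp only [Function.comp_apply, Equiv.swap_apply_def]; grind
  have e₂ : (Equiv.swap i j : V → V) ∘ Equiv.swap i k = Equiv.swap i k ∘ Equiv.swap j k := by
    ext x; simp only [Function.comp_apply, Equiv.swap_apply_def]; grind
  have e₃ : (Equiv.swap i k : V → V) ∘ Equiv.swap i j = Equiv.swap i j ∘ Equiv.swap j k := by
    ext x; simp only [Function.comp_apply, Equiv.swap_apply_def]; grind
  have e₄ : (Equiv.swap i k : V → V) ∘ Equiv.swap i j = Equiv.swap j k ∘ Equiv.swap i k := by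
    ext x; simp only [Function.comp_apply, Equiv.swap_apply_def]; grind
  ext f g
  simp only [Matrix.add_apply, Matrix.sub_apply, swapMat_mul_apply]
  simp only [swapMat, Matrix.of_apply, Matrix.one_apply]
  have hf : f i = f j ∨ f i = f k ∨ f j = f k := by omega
  rcases hf with h | h | h <;> have hc := comp_swap_eq_self h
  · rw [e₃, ← Function.comp_assoc, ← Function.comp_assoc, hc]; ring
  · rw [e₂, ← Function.comp_assoc, ← Function.comp_assoc, hc]; ring
  · rw [e₁, e₄, ← Function.comp_assoc, ← Function.comp_assoc, hc]; ring

theorem singletProj_self {V : Type*} [Fintype V] [DecidableEq V] (i : V) :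
    singletProj i i = 0 := by
  simp [singletProj, swapMat_self]

theorem singletProj_comm {V : Type*} [Fintype V] [DecidableEq V] (i j : V) :
    singletProj i j = singletProj j i := by
  rw [singletProj, singletProj, swapMat_comm]

theorem singletProj_mul_self {V : Type*} [Fintype V] [DecidableEq V] (i j : V) :
    singletProj i j * singletProj i j = singletProj i j := by
  simp only [singletProj, smul_mul_assoc, mul_smul_comm, sub_mul, mul_sub, swapMat_mul_self,
    one_mul, mul_one]
  module

theorem singletProj_anticomm {V : Type*} [Fintype V] [DecidableEq V] {i j k : V}
    (hij : i ≠ j) (hik : i ≠ k) (hjk : j ≠ k) :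
    singletProj i j * singletProj i k + singletProj i k * singletProj i j =
      (2 : ℂ)⁻¹ • (singletProj i j + singletProj i k - singletProj j k) := by
  have h := eq_sub_of_add_eq (swapMat_anticomm hij hik hjk)
  simp only [singletProj, smul_mul_assoc, mul_smul_comm, sub_mul, mul_sub, h,
    one_mul, mul_one]
  module

theorem singletProj_isHermitian {V : Type*} [Fintype V] [DecidableEq V] (i j : V) :
    (singletProj i j).IsHermitian := by
  have h : (swapMat i j).IsHermitian := by
    ext f g
    have : g ∘ Equiv.swap i j = f ↔ f ∘ Equiv.swap i j = g := by
      constructor <;> rintro rfl <;> ext x <;> simp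
    simp [swapMat, this, apply_ite]
  rw [Matrix.IsHermitian, singletProj, conjTranspose_smul, conjTranspose_sub, h.eq]
  simp

theorem singletProj_posSemidef {V : Type*} [Fintype V] [DecidableEq V] (i j : V) :
    (singletProj i j).PosSemidef := by
  have h := posSemidef_conjTranspose_mul_self (singletProj i j)
  rwa [(singletProj_isHermitian i j).eq, singletProj_mul_self] at h

theorem sum_sum_eq_two_smul_sum_Ioi {ι M : Type*} [Fintype ι] [LinearOrder ι]
    [LocallyFiniteOrder ι] [LocallyFiniteOrderTop ι] [AddCommMonoid M]
    (F : ι → ι → M) (hs : ∀ j k, F j k = F k j) (hd : ∀ j, F j j = 0) :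
    ∑ j, ∑ k, F j k = 2 • ∑ j, ∑ k ∈ Ioi j, F j k := by
  have h : ∀ j, ∑ k, F j k = ∑ k ∈ Ioi j, F j k + ∑ k with k < j, F j k := by
    intro j
    rw [← Finset.sum_filter_add_sum_filter_not univ (fun k => j < k)]
    congr 1
    · congr 1; ext; simp
    · symm
      refine Finset.sum_subset (fun k => by simpa using le_of_lt) fun k h₁ h₂ => ?_
      have : k = j := by simp at h₁ h₂; exact le_antisymm h₁ h₂
      rw [this, hd]
  simp_rw [h]
  rw [Finset.sum_add_distrib, two_smul]
  congr 1
  rw [Finset.sum_comm' (t' := univ) (s' := fun k => Ioi k) (by simp)]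
  exact Finset.sum_congr rfl fun j _ => Finset.sum_congr rfl fun k _ => hs _ _

/-- The square of a star Hamiltonian centred at `i` with leaves `a j`. -/
theorem sum_singletProj_sq {V : Type*} [Fintype V] [DecidableEq V] {n : ℕ} (i : V)
    {a : Fin n → V} (ha : Function.Injective a) (hi : ∀ j, i ≠ a j) :
    (∑ j, singletProj i (a j)) ^ 2 =
      (((n : ℂ) + 1) / 2) • ∑ j, singletProj i (a j)
        - (2 : ℂ)⁻¹ • ∑ j, ∑ k ∈ Ioi j, singletProj (a j) (a k) := by
  have hp : ∀ j k, singletProj i (a j) * singletProj i (a k)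
      + singletProj i (a k) * singletProj i (a j) =
      (2 : ℂ)⁻¹ • (singletProj i (a j) + singletProj i (a k) - singletProj (a j) (a k))
        + if j = k then singletProj i (a j) else 0 := by
    intro j k
    by_cases h : j = k
    · subst h
      rw [singletProj_mul_self, singletProj_self, if_pos rfl]
      module
    · rw [if_neg h, add_zero, singletProj_anticomm (hi j) (hi k) (ha.ne h)]
  have h₁ : (∑ j, singletProj i (a j)) ^ 2 =
      ∑ j, ∑ k, singletProj i (a j) * singletProj i (a k) := by
    rw [sq, Finset.sum_mul_sum]
  have h₂ : (∑ j, singletProj i (a j)) ^ 2 =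
      ∑ j, ∑ k, singletProj i (a k) * singletProj i (a j) := by
    rw [h₁, Finset.sum_comm]
  have h₃ : (∑ j, singletProj i (a j)) ^ 2 + (∑ j, singletProj i (a j)) ^ 2 =
      ((n : ℂ) + 1) • ∑ j, singletProj i (a j)
        - (2 : ℂ)⁻¹ • ∑ j, ∑ k, singletProj (a j) (a k) := by
    conv_lhs => arg 1; rw [h₁]
    rw [h₂]
    simp only [← Finset.sum_add_distrib, hp]
    simp only [Finset.sum_add_distrib, ← Finset.smul_sum, Finset.sum_sub_distrib,
      Finset.sum_const, Finset.card_univ, Fintype.card_fin, Finset.sum_ite_eq, Finset.mem_univ,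
      if_true, ← Nat.cast_smul_eq_nsmul ℂ]
    module
  rw [sum_sum_eq_two_smul_sum_Ioi _ (fun _ _ => singletProj_comm _ _)
    (fun _ => singletProj_self _)] at h₃
  have h₄ := congrArg ((2 : ℂ)⁻¹ • ·) h₃
  simp only [← two_smul ℂ (_ ^ 2)] at h₄
  rw [inv_smul_smul₀ two_ne_zero] at h₄
  rw [h₄]
  module

theorem eigenvalues_le_of_posSemidef_sub {ι : Type*} [Fintype ι] [DecidableEq ι]
    {A : Matrix ι ι ℂ} (hA : A.IsHermitian) {c : ℝ}
    (h : ((c : ℂ) • (1 : Matrix ι ι ℂ) - A).PosSemidef) (x : ι) : hA.eigenvalues x ≤ c := by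
  have h₁ := h.re_dotProduct_nonneg (hA.eigenvectorBasis x).ofLp
  have h₂ : star (hA.eigenvectorBasis x).ofLp ⬝ᵥ (hA.eigenvectorBasis x).ofLp = 1 := by
    have h₃ := inner_self_eq_norm_sq_to_K (𝕜 := ℂ) (hA.eigenvectorBasis x)
    rw [EuclideanSpace.inner_eq_star_dotProduct, dotProduct_comm] at h₃
    simpa using h₃
  rw [sub_mulVec, smul_mulVec, one_mulVec, hA.mulVec_eigenvectorBasis, dotProduct_sub,
    dotProduct_smul, dotProduct_smul, h₂] at h₁
  simpa using h₁

/-- Level-1 sum-of-squares identity for the complete bipartite graph `K_{n,m}` (`n ≥ m`):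
`(2/(n+1))·Σ_{i∈B} (((n+1)/2)·I − Σ_{j∈A} H_{ij})² + (m/(n+1))·Σ_{j<k∈A} H_{jk}
  = (m(n+1)/2)·I − H`.  In particular the right-hand side is positive semidefinite and
`λ_max(H) ≤ m(n+1)/2`. -/
theorem stmt9 (n m : ℕ) (hm : 1 ≤ m) (hnm : m ≤ n)
    (hH : (bipartiteHam n m).IsHermitian) :
    ((2 / ((n : ℂ) + 1)) • ∑ i : Fin m,
        ((((n : ℂ) + 1) / 2) • (1 : Matrix ((Fin n ⊕ Fin m) → Fin 2) ((Fin n ⊕ Fin m) → Fin 2) ℂ)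
          - ∑ j : Fin n, singletProj (Sum.inr i) (Sum.inl j)) ^ 2
      + ((m : ℂ) / ((n : ℂ) + 1)) • ∑ j : Fin n, ∑ k ∈ Finset.Ioi j,
          singletProj (Sum.inl j : Fin n ⊕ Fin m) (Sum.inl k)
      = (((m : ℂ) * ((n : ℂ) + 1)) / 2) • 1 - bipartiteHam n m) ∧
    ((((m : ℂ) * ((n : ℂ) + 1)) / 2) •
        (1 : Matrix ((Fin n ⊕ Fin m) → Fin 2) ((Fin n ⊕ Fin m) → Fin 2) ℂ)
      - bipartiteHam n m).PosSemidef ∧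
    (⨆ x, hH.eigenvalues x) ≤ (m : ℝ) * ((n : ℝ) + 1) / 2 := by
  have hn : (n : ℂ) + 1 ≠ 0 := by exact_mod_cast n.succ_ne_zero
  have key : (2 / ((n : ℂ) + 1)) • ∑ i : Fin m,
        ((((n : ℂ) + 1) / 2) • (1 : Matrix ((Fin n ⊕ Fin m) → Fin 2) ((Fin n ⊕ Fin m) → Fin 2) ℂ)
          - ∑ j : Fin n, singletProj (Sum.inr i) (Sum.inl j)) ^ 2
      + ((m : ℂ) / ((n : ℂ) + 1)) • ∑ j : Fin n, ∑ k ∈ Finset.Ioi j,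
          singletProj (Sum.inl j : Fin n ⊕ Fin m) (Sum.inl k)
      = (((m : ℂ) * ((n : ℂ) + 1)) / 2) • 1 - bipartiteHam n m := by
    have hsq : ∀ i : Fin m, ((((n : ℂ) + 1) / 2) •
        (1 : Matrix ((Fin n ⊕ Fin m) → Fin 2) ((Fin n ⊕ Fin m) → Fin 2) ℂ)
          - ∑ j : Fin n, singletProj (Sum.inr i) (Sum.inl j)) ^ 2 =
        (((n : ℂ) + 1) / 2) ^ 2 • 1
          - (((n : ℂ) + 1) / 2) • ∑ j : Fin n, singletProj (Sum.inr i) (Sum.inl j)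
          - (2 : ℂ)⁻¹ • ∑ j : Fin n, ∑ k ∈ Finset.Ioi j,
              singletProj (Sum.inl j : Fin n ⊕ Fin m) (Sum.inl k) := by
      intro i
      have h := sum_singletProj_sq (Sum.inr i : Fin n ⊕ Fin m)
        (Sum.inl_injective (α := Fin n) (β := Fin m)) (by simp)
      rw [sq] at h ⊢
      simp only [sub_mul, mul_sub, smul_mul_assoc, mul_smul_comm, one_mul, mul_one, h]
      module
    simp only [hsq, bipartiteHam, Finset.sum_sub_distrib, ← Finset.smul_sum, Finset.sum_const,
      Finset.card_univ, Fintype.card_fin, ← Nat.cast_smul_eq_nsmul ℂ]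
    match_scalars <;> field_simp <;> ring
  have hpsd : ((((m : ℂ) * ((n : ℂ) + 1)) / 2) •
        (1 : Matrix ((Fin n ⊕ Fin m) → Fin 2) ((Fin n ⊕ Fin m) → Fin 2) ℂ)
      - bipartiteHam n m).PosSemidef := by
    rw [← key]
    refine .add (.smul (posSemidef_sum _ fun i _ => ?_) ?_)
      (.smul (posSemidef_sum _ fun j _ => posSemidef_sum _ fun k _ =>
        singletProj_posSemidef _ _) ?_)
    · have hh : ((((n : ℂ) + 1) / 2) •
          (1 : Matrix ((Fin n ⊕ Fin m) → Fin 2) ((Fin n ⊕ Fin m) → Fin 2) ℂ)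
          - ∑ j : Fin n, singletProj (Sum.inr i) (Sum.inl j)).IsHermitian := by
        rw [Matrix.IsHermitian, conjTranspose_sub, conjTranspose_smul, conjTranspose_sum]
        simp [(singletProj_isHermitian _ _).eq]
      rw [sq]
      nth_rewrite 1 [← hh.eq]
      exact posSemidef_conjTranspose_mul_self _
    · have h : (0 : ℂ) ≤ ((2 / ((n : ℝ) + 1) : ℝ) : ℂ) :=
        Complex.zero_le_real.mpr (by positivity)
      simpa using h
    · have h : (0 : ℂ) ≤ (((m : ℝ) / ((n : ℝ) + 1) : ℝ) : ℂ) :=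
        Complex.zero_le_real.mpr (by positivity)
      simpa using h
  refine ⟨key, hpsd, ciSup_le fun x => eigenvalues_le_of_posSemidef_sub hH ?_ x⟩
  convert hpsd using 3
  push_cast
  ring

end
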